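/- arXiv:quant-ph/9609025 — 2 statements merged into one kernel-verified Lean document; each statement's English description precedes it below -/
import Mathlib

section
/- Fix ν ∈ ℝ and let Q be an admissible quantization of P¹ of type (i)′ with parameter ν. Then there exists η ∈ ℝ such that Q = Q_{ν,η}; that is, for all real trigonometric polynomials f, g and all ψ ∈ D, Q(f(θ)ℓ + g(θ))ψ = −i f ψ′ + ((η − i/2) f′ + ν f + g) ψ. -/
noncomputable section

open Complex

/-- Partial derivative in the first (angle) variable. -/
def pdTheta (f : ℝ × ℝ → ℝ) : ℝ × ℝ → ℝ := fun p => deriv (fun t => f (t, p.2)) p.1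

/-- Partial derivative in the second (momentum) variable. -/
def pdEll (f : ℝ × ℝ → ℝ) : ℝ × ℝ → ℝ := fun p => deriv (fun l => f (p.1, l)) p.2

/-- Poisson bracket `{f,g} = f_ℓ g_θ − f_θ g_ℓ`. -/
def pb (f g : ℝ × ℝ → ℝ) : ℝ × ℝ → ℝ :=
  fun p => pdEll f p * pdTheta g p - pdTheta f p * pdEll g p

/-- Spanning set for the polynomial algebra `P`. -/
def PGens : Set (ℝ × ℝ → ℝ) :=
  {h | ∃ r m : ℕ, h = (fun p : ℝ × ℝ => p.2 ^ r * Real.sin (m * p.1)) ∨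
       h = (fun p : ℝ × ℝ => p.2 ^ r * Real.cos (m * p.1))}

/-- The polynomial algebra `P`. -/
def P : Submodule ℝ (ℝ × ℝ → ℝ) := Submodule.span ℝ PGens

def fone : ℝ × ℝ → ℝ := fun _ => 1
def fell : ℝ × ℝ → ℝ := fun p => p.2
def fsin : ℝ × ℝ → ℝ := fun p => Real.sin p.1
def fcos : ℝ × ℝ → ℝ := fun p => Real.cos p.1

lemma fone_mem_P : fone ∈ P :=
  Submodule.subset_span ⟨0, 0, Or.inr (by funext p; simp [fone])⟩

lemma fell_mem_P : fell ∈ P :=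
  Submodule.subset_span ⟨1, 0, Or.inr (by funext p; simp [fell])⟩

lemma fsin_mem_P : fsin ∈ P :=
  Submodule.subset_span ⟨0, 1, Or.inl (by funext p; simp [fsin])⟩

lemma fcos_mem_P : fcos ∈ P :=
  Submodule.subset_span ⟨0, 1, Or.inr (by funext p; simp [fcos])⟩

/-- The domain `D = C^∞(S¹,ℂ)`: smooth `2π`-periodic functions. -/
def Dom : Submodule ℂ (ℝ → ℂ) where
  carrier := {ψ | ContDiff ℝ (⊤ : ℕ∞) ψ ∧ ∀ t, ψ (t + 2 * Real.pi) = ψ t}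
  add_mem' := by
    intro a b ha hb
    exact ⟨ha.1.add hb.1, fun t => by simp [Pi.add_apply, ha.2 t, hb.2 t]⟩
  zero_mem' := ⟨contDiff_const, fun t => rfl⟩
  smul_mem' := by
    intro c a ha
    exact ⟨ha.1.const_smul c, fun t => by simp [Pi.smul_apply, ha.2 t]⟩

/-- The `L²` inner product on `D`. -/
def ip (φ ψ : ℝ → ℂ) : ℂ := ∫ t in (0:ℝ)..(2 * Real.pi), (starRingEnd ℂ) (φ t) * ψ t

/-- Symmetric operator on `D`. -/
def SymmetricOp (A : Dom →ₗ[ℂ] Dom) : Prop :=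
  ∀ φ ψ : Dom, ip (A φ : ℝ → ℂ) (ψ : ℝ → ℂ) = ip (φ : ℝ → ℂ) (A ψ : ℝ → ℂ)

/-- An admissible quantization of type (i)′ with parameter ν of a Lie subalgebra
`O ⊆ P` containing the basic set. -/
structure IsQuant (O : Submodule ℝ (ℝ × ℝ → ℝ)) (ν : ℝ)
    (Q : O →ₗ[ℝ] (Dom →ₗ[ℂ] Dom)) : Prop where
  map_bracket : ∀ (f g : O) (h : pb f g ∈ O),
    Q ⟨pb f g, h⟩ = Complex.I • (Q f ∘ₗ Q g - Q g ∘ₗ Q f)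
  map_one : ∀ h : fone ∈ O, Q ⟨fone, h⟩ = LinearMap.id
  symm : ∀ f : O, SymmetricOp (Q f)
  map_ell : ∀ (h : fell ∈ O) (ψ : Dom) (t : ℝ),
    (Q ⟨fell, h⟩ ψ : ℝ → ℂ) t = -Complex.I * deriv (ψ : ℝ → ℂ) t + (ν : ℂ) * (ψ : ℝ → ℂ) t
  map_sin : ∀ (h : fsin ∈ O) (ψ : Dom) (t : ℝ),
    (Q ⟨fsin, h⟩ ψ : ℝ → ℂ) t = (Real.sin t : ℂ) * (ψ : ℝ → ℂ) t
  map_cos : ∀ (h : fcos ∈ O) (ψ : Dom) (t : ℝ),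
    (Q ⟨fcos, h⟩ ψ : ℝ → ℂ) t = (Real.cos t : ℂ) * (ψ : ℝ → ℂ) t

end
noncomputable section
/-- Spanning set of real trigonometric polynomials. -/
def TrigGens : Set (ℝ → ℝ) :=
  {h | ∃ m : ℕ, h = (fun t => Real.sin (m * t)) ∨ h = fun t => Real.cos (m * t)}

/-- Real trigonometric polynomials. -/
def Trig : Submodule ℝ (ℝ → ℝ) := Submodule.span ℝ TrigGens

/-- Spanning set for `P¹`, the elements of `P` of degree at most 1 in `ℓ`. -/
def P1Gens : Set (ℝ × ℝ → ℝ) :=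
  {h | ∃ r m : ℕ, r ≤ 1 ∧
        (h = (fun p : ℝ × ℝ => p.2 ^ r * Real.sin (m * p.1)) ∨
         h = (fun p : ℝ × ℝ => p.2 ^ r * Real.cos (m * p.1)))}

/-- `P¹ ⊆ P`: polynomials affine in the momentum `ℓ`. -/
def P1 : Submodule ℝ (ℝ × ℝ → ℝ) := Submodule.span ℝ P1Gens

lemma fone_mem_P1 : fone ∈ P1 :=
  Submodule.subset_span ⟨0, 0, Nat.zero_le 1, Or.inr (by funext p; simp [fone])⟩
lemma fell_mem_P1 : fell ∈ P1 :=
  Submodule.subset_span ⟨1, 0, le_refl 1, Or.inr (by funext p; simp [fell])⟩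
lemma fsin_mem_P1 : fsin ∈ P1 :=
  Submodule.subset_span ⟨0, 1, Nat.zero_le 1, Or.inl (by funext p; simp [fsin])⟩
lemma fcos_mem_P1 : fcos ∈ P1 :=
  Submodule.subset_span ⟨0, 1, Nat.zero_le 1, Or.inr (by funext p; simp [fcos])⟩
end
noncomputable section
theorem trig_span_ind {p : (ℝ → ℝ) → Prop} (hs : ∀ m : ℕ, p (fun t => Real.sin (m * t)))
    (hc : ∀ m : ℕ, p (fun t => Real.cos (m * t))) (hz : p 0)
    (ha : ∀ f g, f ∈ Trig → g ∈ Trig → p f → p g → p (f + g)) (hm : ∀ (a : ℝ) f, f ∈ Trig → p f → p (a • f))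
    {f : ℝ → ℝ} (hf : f ∈ Trig) : p f := by
  refine Submodule.span_induction (p := fun x _ => p x) ?_ hz (fun x y hx hy => ha x y hx hy)
    (fun a x hx => hm a x hx) hf
  rintro x ⟨m, rfl | rfl⟩
  · exact hs m
  · exact hc m

theorem sin_mem (m : ℕ) : (fun t => Real.sin (m * t)) ∈ Trig :=
  Submodule.subset_span ⟨m, Or.inl rfl⟩
theorem cos_mem (m : ℕ) : (fun t => Real.cos (m * t)) ∈ Trig :=
  Submodule.subset_span ⟨m, Or.inr rfl⟩

theorem sin_memZ (m : ℤ) : (fun t => Real.sin (m * t)) ∈ Trig := by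
  obtain ⟨n, rfl | rfl⟩ := m.eq_nat_or_neg
  · simpa using sin_mem n
  · convert Trig.neg_mem (sin_mem n) using 1
    funext t
    simp
theorem cos_memZ (m : ℤ) : (fun t => Real.cos (m * t)) ∈ Trig := by
  obtain ⟨n, rfl | rfl⟩ := m.eq_nat_or_neg
  · simpa using cos_mem n
  · convert cos_mem n using 1
    funext t
    simp

theorem ss_mem (m n : ℕ) : (fun t => Real.sin (m * t)) * (fun t => Real.sin (n * t)) ∈ Trig := by
  convert Trig.smul_mem (1/2 : ℝ) (Trig.sub_mem (cos_memZ (m - n)) (cos_memZ (m + n))) using 1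
  funext t
  simp [sub_mul, add_mul, Real.cos_sub, Real.cos_add]
  ring
theorem cc_mem (m n : ℕ) : (fun t => Real.cos (m * t)) * (fun t => Real.cos (n * t)) ∈ Trig := by
  convert Trig.smul_mem (1/2 : ℝ) (Trig.add_mem (cos_memZ (m - n)) (cos_memZ (m + n))) using 1
  funext t
  simp [sub_mul, add_mul, Real.cos_sub, Real.cos_add]
  ring
theorem sc_mem (m n : ℕ) : (fun t => Real.sin (m * t)) * (fun t => Real.cos (n * t)) ∈ Trig := by
  convert Trig.smul_mem (1/2 : ℝ) (Trig.add_mem (sin_memZ (m - n)) (sin_memZ (m + n))) using 1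
  funext t
  simp [sub_mul, add_mul, Real.sin_sub, Real.sin_add]
  ring

theorem trig_mul {f g : ℝ → ℝ} (hf : f ∈ Trig) (hg : g ∈ Trig) : f * g ∈ Trig := by
  refine trig_span_ind (p := fun f => f * g ∈ Trig) ?_ ?_ ?_ ?_ ?_ hf
  · intro m
    refine trig_span_ind (p := fun g => _ * g ∈ Trig) ?_ ?_ ?_ ?_ ?_ hg
    · exact ss_mem m
    · exact sc_mem m
    · simp
    · intro f g _ _ h1 h2; rw [mul_add]; exact Trig.add_mem h1 h2
    · intro a f _ h; rw [mul_smul_comm]; exact Trig.smul_mem _ h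
  · intro m
    refine trig_span_ind (p := fun g => _ * g ∈ Trig) ?_ ?_ ?_ ?_ ?_ hg
    · intro n; rw [mul_comm]; exact sc_mem n m
    · exact cc_mem m
    · simp
    · intro f g _ _ h1 h2; rw [mul_add]; exact Trig.add_mem h1 h2
    · intro a f _ h; rw [mul_smul_comm]; exact Trig.smul_mem _ h
  · simp
  · intro f g _ _ h1 h2; rw [add_mul]; exact Trig.add_mem h1 h2
  · intro a f _ h; rw [smul_mul_assoc]; exact Trig.smul_mem _ h

theorem trig_smooth {f : ℝ → ℝ} (hf : f ∈ Trig) : ContDiff ℝ (⊤ : ℕ∞) f := by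
  refine trig_span_ind (p := fun f => ContDiff ℝ (⊤ : ℕ∞) f) ?_ ?_ ?_ ?_ ?_ hf
  · intro m; fun_prop
  · intro m; fun_prop
  · exact contDiff_const
  · intro f g _ _ h1 h2; exact h1.add h2
  · intro a f _ h; exact h.const_smul a

theorem trig_diff {f : ℝ → ℝ} (hf : f ∈ Trig) : Differentiable ℝ f :=
  (trig_smooth hf).differentiable (by simp)

theorem deriv_sin_m (m : ℕ) : deriv (fun t : ℝ => Real.sin (m * t)) = fun t => m * Real.cos (m * t) := by
  funext t
  simp [mul_comm] 
theorem deriv_cos_m (m : ℕ) : deriv (fun t : ℝ => Real.cos (m * t)) = fun t => -(m * Real.sin (m * t)) := by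
  funext t
  simp [mul_comm] 

theorem trig_deriv {f : ℝ → ℝ} (hf : f ∈ Trig) : deriv f ∈ Trig := by
  refine trig_span_ind (p := fun f => deriv f ∈ Trig) ?_ ?_ ?_ ?_ ?_ hf
  · intro m; rw [deriv_sin_m]; exact Trig.smul_mem (m : ℝ) (cos_mem m)
  · intro m; rw [deriv_cos_m]; exact Trig.neg_mem (Trig.smul_mem (m : ℝ) (sin_mem m))
  · have : deriv (0 : ℝ → ℝ) = 0 := by funext t; simp
    rw [this]; exact Trig.zero_mem
  · intro f g hf hg h1 h2
    have : deriv (f + g) = deriv f + deriv g := by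
      funext t; exact deriv_add (trig_diff hf t) (trig_diff hg t)
    rw [this]; exact Trig.add_mem h1 h2
  · intro a f hf h
    have : deriv (a • f) = a • deriv f := by
      funext t; exact deriv_const_smul a (trig_diff hf t)
    rw [this]; exact Trig.smul_mem _ h

theorem trig_per {f : ℝ → ℝ} (hf : f ∈ Trig) (t : ℝ) : f (t + 2 * Real.pi) = f t := by
  refine trig_span_ind (p := fun f => f (t + 2 * Real.pi) = f t) ?_ ?_ ?_ ?_ ?_ hf
  · intro m; simp only [mul_add]; exact Real.sin_add_nat_mul_two_pi _ m
  · intro m; simp only [mul_add]; exact Real.cos_add_nat_mul_two_pi _ m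
  · rfl
  · intro f g _ _ h1 h2; simp [h1, h2]
  · intro a f _ h; simp [h]

def L0 : Trig →ₗ[ℝ] P1 where
  toFun g := ⟨fun p => (g : ℝ → ℝ) p.1, by
    refine trig_span_ind (p := fun g => (fun p : ℝ × ℝ => g p.1) ∈ P1) ?_ ?_ ?_ ?_ ?_ g.2
    · intro m; exact Submodule.subset_span ⟨0, m, by simp, Or.inl (by simp)⟩
    · intro m; exact Submodule.subset_span ⟨0, m, by simp, Or.inr (by simp)⟩
    · exact P1.zero_mem
    · intro f g _ _ h1 h2; exact P1.add_mem h1 h2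
    · intro a f _ h; exact P1.smul_mem a h⟩
  map_add' _ _ := rfl
  map_smul' _ _ := rfl

def L1 : Trig →ₗ[ℝ] P1 where
  toFun g := ⟨fun p => (g : ℝ → ℝ) p.1 * p.2, by
    refine trig_span_ind (p := fun g => (fun p : ℝ × ℝ => g p.1 * p.2) ∈ P1) ?_ ?_ ?_ ?_ ?_ g.2
    · intro m; exact Submodule.subset_span ⟨1, m, by simp, Or.inl (by simp [mul_comm])⟩
    · intro m; exact Submodule.subset_span ⟨1, m, by simp, Or.inr (by simp [mul_comm])⟩
    · convert P1.zero_mem using 1; funext p; simp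
    · intro f g _ _ h1 h2; convert P1.add_mem h1 h2 using 1; funext p; simp [add_mul]
    · intro a f _ h; convert P1.smul_mem a h using 1; funext p; simp [mul_assoc]⟩
  map_add' _ _ := by ext p; simp [add_mul]
  map_smul' _ _ := by ext p; simp [mul_assoc]

theorem pdE0 (f : ℝ → ℝ) : pdEll (fun p => f p.1) = fun _ => 0 := by
  funext p; simp [pdEll]
theorem pdE1 (f : ℝ → ℝ) : pdEll (fun p => f p.1 * p.2) = fun p => f p.1 := by
  funext p; simp [pdEll]
theorem pdT0 (f : ℝ → ℝ) : pdTheta (fun p => f p.1) = fun p => deriv f p.1 := by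
  funext p; simp [pdTheta]
theorem pdT1 (f : ℝ → ℝ) : pdTheta (fun p => f p.1 * p.2) = fun p => deriv f p.1 * p.2 := by
  funext p; simp [pdTheta]

theorem brk {ν : ℝ} {Q : P1 →ₗ[ℝ] (Dom →ₗ[ℂ] Dom)} (hQ : IsQuant P1 ν Q) (f g h : P1)
    (e : pb f g = h) : Q h = Complex.I • (Q f ∘ₗ Q g - Q g ∘ₗ Q f) := by
  have := hQ.map_bracket f g (e ▸ h.2)
  rw [← this]
  congr 1
  exact Subtype.ext e.symm

theorem brk00 {ν : ℝ} {Q : P1 →ₗ[ℝ] (Dom →ₗ[ℂ] Dom)} (hQ : IsQuant P1 ν Q) (f g : Trig) (ψ : Dom) :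
    Q (L0 f) (Q (L0 g) ψ) = Q (L0 g) (Q (L0 f) ψ) := by
  have := brk hQ (L0 f) (L0 g) 0 (by funext p; simp [L0, pb, pdE0])
  rw [map_zero] at this
  have := (smul_eq_zero.1 this.symm).resolve_left Complex.I_ne_zero
  exact sub_eq_zero.1 (congrArg (fun A : Dom →ₗ[ℂ] Dom => A ψ) this)

theorem brk10 {ν : ℝ} {Q : P1 →ₗ[ℝ] (Dom →ₗ[ℂ] Dom)} (hQ : IsQuant P1 ν Q) (f g h : Trig)
    (e : ∀ t, (h : ℝ → ℝ) t = (f : ℝ → ℝ) t * deriv (g : ℝ → ℝ) t) (ψ : Dom) :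
    Q (L0 h) ψ = Complex.I • (Q (L1 f) (Q (L0 g) ψ) - Q (L0 g) (Q (L1 f) ψ)) := by
  have := brk hQ (L1 f) (L0 g) (L0 h) (by funext p; simp [L0, L1, pb, pdE0, pdE1, pdT0, pdT1, e])
  rw [this]; rfl

theorem brk11 {ν : ℝ} {Q : P1 →ₗ[ℝ] (Dom →ₗ[ℂ] Dom)} (hQ : IsQuant P1 ν Q) (f g h : Trig)
    (e : ∀ t, (h : ℝ → ℝ) t = (f : ℝ → ℝ) t * deriv (g : ℝ → ℝ) t - deriv (f : ℝ → ℝ) t * (g : ℝ → ℝ) t)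
    (ψ : Dom) :
    Q (L1 h) ψ = Complex.I • (Q (L1 f) (Q (L1 g) ψ) - Q (L1 g) (Q (L1 f) ψ)) := by
  have := brk hQ (L1 f) (L1 g) (L1 h) (by
    funext p; simp [L1, pb, pdE1, pdT1, e]; ring)
  rw [this]; rfl

def sn (n : ℕ) : Trig := ⟨_, sin_mem n⟩
def cn (n : ℕ) : Trig := ⟨_, cos_mem n⟩
@[simp] theorem sn_apply (n : ℕ) (t : ℝ) : (sn n : ℝ → ℝ) t = Real.sin (n * t) := rfl
@[simp] theorem cn_apply (n : ℕ) (t : ℝ) : (cn n : ℝ → ℝ) t = Real.cos (n * t) := rfl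
@[simp] theorem sn_deriv (n : ℕ) (t : ℝ) : deriv (sn n : ℝ → ℝ) t = n * Real.cos (n * t) :=
  congrFun (deriv_sin_m n) t
@[simp] theorem cn_deriv (n : ℕ) (t : ℝ) : deriv (cn n : ℝ → ℝ) t = -(n * Real.sin (n * t)) :=
  congrFun (deriv_cos_m n) t

theorem fourier_uniq (F : ℝ → ℂ) (hF : Continuous F) (hp : ∀ t, F (t + 2 * Real.pi) = F t)
    (hc : ∀ n : ℕ, ∫ t in (0:ℝ)..(2 * Real.pi), F t * (Real.cos (n * t) : ℂ) = 0)
    (hs : ∀ n : ℕ, ∫ t in (0:ℝ)..(2 * Real.pi), F t * (Real.sin (n * t) : ℂ) = 0) : ∀ t, F t = 0 := by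
  have : Fact (0 < 2 * Real.pi) := ⟨by positivity⟩
  have hper : Function.Periodic F (2 * Real.pi) := hp
  let G : C(AddCircle (2 * Real.pi), ℂ) := ⟨hper.lift, by
    exact continuous_quot_lift _ hF⟩
  have hcs : ∀ n : ℤ, ∫ t in (0:ℝ)..(2 * Real.pi), F t * (Real.cos (n * t) : ℂ) = 0 ∧
      ∫ t in (0:ℝ)..(2 * Real.pi), F t * (Real.sin (n * t) : ℂ) = 0 := by
    intro n
    obtain ⟨m, rfl | rfl⟩ := n.eq_nat_or_neg
    · exact ⟨by simpa using hc m, by simpa using hs m⟩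
    · exact ⟨by simpa using hc m, by simpa using hs m⟩
  have hco : ∀ n : ℤ, fourierCoeff G n = 0 := by
    intro n
    rw [fourierCoeff_eq_intervalIntegral G n 0]
    have : ∀ x : ℝ, (fourier (-n) (x : AddCircle (2 * Real.pi)) : ℂ) • G x =
      F x * (Real.cos (n * x) : ℂ) - Complex.I * (F x * (Real.sin (n * x) : ℂ)) := by
      intro x
      rw [fourier_coe_apply]
      have h1 : G x = F x := rfl
      rw [h1]
      have h2 : 2 * (Real.pi : ℂ) * Complex.I * ((-n : ℤ) : ℂ) * x / ((2 * Real.pi : ℝ) : ℂ) =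
        ((-(n * x) : ℝ) : ℂ) * Complex.I := by
        have : (Real.pi : ℂ) ≠ 0 := by exact_mod_cast Real.pi_ne_zero
        push_cast
        field_simp
      rw [h2, Complex.exp_mul_I, ← Complex.ofReal_cos, ← Complex.ofReal_sin, Real.cos_neg, Real.sin_neg]
      simp only [smul_eq_mul]
      push_cast
      ring
    simp only [this, zero_add]
    rw [intervalIntegral.integral_sub, intervalIntegral.integral_const_mul, (hcs n).1, (hcs n).2]
    · simp
    · apply Continuous.intervalIntegrable; fun_prop
    · apply Continuous.intervalIntegrable; fun_prop
  have hz : Summable (fourierCoeff G) := by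
    have : fourierCoeff G = fun _ => 0 := funext hco
    rw [this]; exact summable_zero
  have h := hasSum_fourier_series_of_summable hz
  simp only [hco, zero_smul] at h
  have : G = 0 := h.unique hasSum_zero
  intro t
  exact congrArg (fun H : C(AddCircle (2 * Real.pi), ℂ) => H (t : AddCircle (2 * Real.pi))) this

section
variable {ν : ℝ} {Q : P1 →ₗ[ℝ] (Dom →ₗ[ℂ] Dom)}

theorem Q_sn1 (hQ : IsQuant P1 ν Q) (ψ : Dom) (t : ℝ) :
    (Q (L0 (sn 1)) ψ : ℝ → ℂ) t = (Real.sin t : ℂ) * (ψ : ℝ → ℂ) t := by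
  have : L0 (sn 1) = ⟨fsin, fsin_mem_P1⟩ := by ext p; simp [L0, fsin]
  rw [this, hQ.map_sin]

theorem Q_cn1 (hQ : IsQuant P1 ν Q) (ψ : Dom) (t : ℝ) :
    (Q (L0 (cn 1)) ψ : ℝ → ℂ) t = (Real.cos t : ℂ) * (ψ : ℝ → ℂ) t := by
  have : L0 (cn 1) = ⟨fcos, fcos_mem_P1⟩ := by ext p; simp [L0, fcos]
  rw [this, hQ.map_cos]

theorem Q_cn0 (hQ : IsQuant P1 ν Q) (ψ : Dom) : Q (L0 (cn 0)) ψ = ψ := by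
  have : L0 (cn 0) = ⟨fone, fone_mem_P1⟩ := by ext p; simp [L0, fone]
  rw [this, hQ.map_one]; rfl

theorem Q_ell (hQ : IsQuant P1 ν Q) (ψ : Dom) (t : ℝ) :
    (Q (L1 (cn 0)) ψ : ℝ → ℂ) t = -Complex.I * deriv (ψ : ℝ → ℂ) t + (ν : ℂ) * (ψ : ℝ → ℂ) t := by
  have : L1 (cn 0) = ⟨fell, fell_mem_P1⟩ := by ext p; simp [L1, fell]
  rw [this, hQ.map_ell]

theorem sn0 : sn 0 = 0 := by ext t; simp

theorem key (hQ : IsQuant P1 ν Q) (f h1 h2 : Trig)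
    (e1 : ∀ t, (h1 : ℝ → ℝ) t = (f : ℝ → ℝ) t * Real.cos t)
    (e2 : ∀ t, (h2 : ℝ → ℝ) t = (f : ℝ → ℝ) t * -Real.sin t) (ψ : Dom) (t : ℝ) :
    (Real.sin t : ℂ) * (Q (L0 h1) ψ : ℝ → ℂ) t + (Real.cos t : ℂ) * (Q (L0 h2) ψ : ℝ → ℂ) t = 0 := by
  have b1 := brk10 hQ f (sn 1) h1 (by intro t; simp [e1])
  have b2 := brk10 hQ f (cn 1) h2 (by intro t; simp [e2])
  have hsc : ∀ φ : Dom, Q (L0 (sn 1)) (Q (L0 (sn 1)) φ) + Q (L0 (cn 1)) (Q (L0 (cn 1)) φ) = φ := by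
    intro φ
    ext t
    simp only [Submodule.coe_add, Pi.add_apply, Q_sn1 hQ, Q_cn1 hQ]
    have : (Real.sin t : ℂ) ^ 2 + (Real.cos t : ℂ) ^ 2 = 1 := by exact_mod_cast Real.sin_sq_add_cos_sq t
    linear_combination ((φ : ℝ → ℂ) t) * this
  have k1 := b1 (Q (L0 (sn 1)) ψ)
  have k2 := b2 (Q (L0 (cn 1)) ψ)
  have k3 := congrArg (Q (L0 (sn 1))) (b1 ψ)
  have k4 := congrArg (Q (L0 (cn 1))) (b2 ψ)
  rw [brk00 hQ] at k1 k2
  rw [map_smul, map_sub] at k3 k4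
  have hs1 := congrArg (Q (L1 f)) (hsc ψ)
  rw [map_add] at hs1
  have hs2 := hsc (Q (L1 f) ψ)
  have ev : ∀ {x y : Dom}, x = y → (x : ℝ → ℂ) t = (y : ℝ → ℂ) t := fun h => by rw [h]
  replace k1 := ev k1
  replace k2 := ev k2
  replace k3 := ev k3
  replace k4 := ev k4
  replace hs1 := ev hs1
  replace hs2 := ev hs2
  simp only [Submodule.coe_add, Submodule.coe_sub, Submodule.coe_smul, Pi.add_apply, Pi.sub_apply, Pi.smul_apply,
    smul_eq_mul] at k1 k2 k3 k4 hs1 hs2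
  rw [← Q_sn1 hQ, ← Q_cn1 hQ]
  linear_combination (1/2 : ℂ) * (k1 + k2 + k3 + k4) + Complex.I / 2 * (hs1 - hs2)

theorem Q0_cs (hQ : IsQuant P1 ν Q) (n : ℕ) : ∀ (ψ : Dom) (t : ℝ),
    (Q (L0 (cn n)) ψ : ℝ → ℂ) t = (Real.cos (n * t) : ℂ) * (ψ : ℝ → ℂ) t ∧
    (Q (L0 (sn n)) ψ : ℝ → ℂ) t = (Real.sin (n * t) : ℂ) * (ψ : ℝ → ℂ) t := by
  induction n using Nat.twoStepInduction with
  | zero => intro ψ t; rw [sn0, Q_cn0 hQ]; simp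
  | one => intro ψ t; rw [Q_cn1 hQ, Q_sn1 hQ]; simp
  | more n ih _ =>
    intro ψ t
    obtain ⟨i1, i2⟩ := ih ψ t
    have ec : ∀ t : ℝ, Real.cos (((n + 1 : ℕ) : ℝ) * t) = Real.cos (n * t) * Real.cos t - Real.sin (n * t) * Real.sin t := by
      intro t; push_cast; rw [add_mul, Real.cos_add, one_mul]
    have es : ∀ t : ℝ, Real.sin (((n + 1 : ℕ) : ℝ) * t) = Real.sin (n * t) * Real.cos t + Real.cos (n * t) * Real.sin t := by
      intro t; push_cast; rw [add_mul, Real.sin_add, one_mul]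
    have ec2 : ∀ t : ℝ, Real.cos (((n + 2 : ℕ) : ℝ) * t) = Real.cos (n * t) * (Real.cos t ^ 2 - Real.sin t ^ 2) - Real.sin (n * t) * (2 * Real.sin t * Real.cos t) := by
      intro t; push_cast; rw [add_mul, Real.cos_add, Real.cos_two_mul', Real.sin_two_mul]
    have es2 : ∀ t : ℝ, Real.sin (((n + 2 : ℕ) : ℝ) * t) = Real.sin (n * t) * (Real.cos t ^ 2 - Real.sin t ^ 2) + Real.cos (n * t) * (2 * Real.sin t * Real.cos t) := by
      intro t; push_cast; rw [add_mul, Real.sin_add, Real.cos_two_mul', Real.sin_two_mul]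
    have k1 := key hQ (cn (n + 1)) ((1/2 : ℝ) • (cn (n + 2) + cn n)) (-((1/2 : ℝ) • (sn (n + 2) - sn n)))
      (by
        intro t
        simp only [Submodule.coe_add, Submodule.coe_smul, Pi.add_apply, Pi.smul_apply, smul_eq_mul, cn_apply, ec, ec2]
        linear_combination (-(1/2 : ℝ)) * Real.cos (n * t) * Real.sin_sq_add_cos_sq t)
      (by
        intro t
        simp only [Submodule.coe_neg, Submodule.coe_sub, Submodule.coe_smul, Pi.neg_apply, Pi.sub_apply, Pi.smul_apply, smul_eq_mul, cn_apply, sn_apply, ec, es2]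
        linear_combination (-(1/2 : ℝ)) * Real.sin (n * t) * Real.sin_sq_add_cos_sq t) ψ t
    have k2 := key hQ (sn (n + 1)) ((1/2 : ℝ) • (sn (n + 2) + sn n)) (((1/2 : ℝ) • (cn (n + 2) - cn n)))
      (by
        intro t
        simp only [Submodule.coe_add, Submodule.coe_smul, Pi.add_apply, Pi.smul_apply, smul_eq_mul, sn_apply, es, es2]
        linear_combination (-(1/2 : ℝ)) * Real.sin (n * t) * Real.sin_sq_add_cos_sq t)
      (by
        intro t
        simp only [Submodule.coe_sub, Submodule.coe_smul, Pi.sub_apply, Pi.smul_apply, smul_eq_mul, cn_apply, sn_apply, es, ec2]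
        linear_combination ((1/2 : ℝ)) * Real.cos (n * t) * Real.sin_sq_add_cos_sq t) ψ t
    have sc : (Real.sin t : ℂ) ^ 2 + (Real.cos t : ℂ) ^ 2 = 1 := by exact_mod_cast Real.sin_sq_add_cos_sq t
    simp only [map_neg, map_smul, map_add, map_sub, LinearMap.neg_apply, LinearMap.smul_apply, LinearMap.add_apply,
      LinearMap.sub_apply, Submodule.coe_add, Submodule.coe_sub, Submodule.coe_neg, SetLike.val_smul_of_tower,
      Pi.add_apply, Pi.sub_apply, Pi.neg_apply, Pi.smul_apply, Complex.real_smul, i1, i2] at k1 k2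
    rw [ec2, es2]
    push_cast at *
    set a := (Q (L0 (cn (n + 2))) ψ : ℝ → ℂ) t
    set b := (Q (L0 (sn (n + 2))) ψ : ℝ → ℂ) t
    generalize Complex.sin t = s at *
    generalize Complex.cos t = c at *
    constructor
    · linear_combination 2 * s * k1 + 2 * c * k2 - a * sc
    · linear_combination -2 * c * k1 + 2 * s * k2 - b * sc

theorem Q0_all (hQ : IsQuant P1 ν Q) (f : Trig) (ψ : Dom) (t : ℝ) :
    (Q (L0 f) ψ : ℝ → ℂ) t = ((f : ℝ → ℝ) t : ℂ) * (ψ : ℝ → ℂ) t := by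
  obtain ⟨f, hf⟩ := f
  refine Submodule.span_induction (p := fun f hf => (Q (L0 ⟨f, hf⟩) ψ : ℝ → ℂ) t = (f t : ℂ) * (ψ : ℝ → ℂ) t) ?_ ?_ ?_ ?_ hf
  · rintro x ⟨m, rfl | rfl⟩
    · exact (Q0_cs hQ m ψ t).2
    · exact (Q0_cs hQ m ψ t).1
  · have : (⟨0, Trig.zero_mem⟩ : Trig) = 0 := rfl
    erw [this]; simp
  · intro x y hx hy h1 h2
    have : (⟨x + y, Trig.add_mem hx hy⟩ : Trig) = ⟨x, hx⟩ + ⟨y, hy⟩ := rfl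
    erw [this]
    rw [map_add, map_add, LinearMap.add_apply, Submodule.coe_add, Pi.add_apply, h1, h2, Pi.add_apply]
    push_cast; ring
  · intro a x hx h1
    have : (⟨a • x, Trig.smul_mem a hx⟩ : Trig) = a • ⟨x, hx⟩ := rfl
    erw [this]
    rw [map_smul, map_smul, LinearMap.smul_apply, SetLike.val_smul_of_tower, Pi.smul_apply, h1, Pi.smul_apply, Complex.real_smul]
    simp [mul_assoc]


theorem dom_hd (ψ : Dom) (t : ℝ) : HasDerivAt (ψ : ℝ → ℂ) (deriv (ψ : ℝ → ℂ) t) t :=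
  ((ψ.2.1.differentiable (by simp)) t).hasDerivAt
theorem dom_cont (ψ : Dom) : Continuous (ψ : ℝ → ℂ) := ψ.2.1.continuous
theorem dom_dcont (ψ : Dom) : Continuous (deriv (ψ : ℝ → ℂ)) := ψ.2.1.continuous_deriv (by simp)
theorem dom_dper (ψ : Dom) (t : ℝ) : deriv (ψ : ℝ → ℂ) (t + 2 * Real.pi) = deriv (ψ : ℝ → ℂ) t := by
  rw [← deriv_comp_add_const]
  congr 1
  exact funext ψ.2.2

theorem tr_hd (f : Trig) (t : ℝ) : HasDerivAt (f : ℝ → ℝ) (deriv (f : ℝ → ℝ) t) t :=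
  (trig_diff f.2 t).hasDerivAt
theorem tr_cont (f : Trig) : Continuous (f : ℝ → ℝ) := (trig_smooth f.2).continuous
theorem tr_dcont (f : Trig) : Continuous (deriv (f : ℝ → ℝ)) := (trig_smooth (trig_deriv f.2)).continuous

def dT (f : Trig) : Trig := ⟨deriv f, trig_deriv f.2⟩

def oneD : Dom := ⟨fun _ => 1, contDiff_const, fun _ => rfl⟩
@[simp] theorem oneD_apply (t : ℝ) : (oneD : ℝ → ℂ) t = 1 := rfl
@[simp] theorem oneD_deriv (t : ℝ) : deriv (oneD : ℝ → ℂ) t = 0 := by simp [oneD]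

def Tf (ν : ℝ) (Q : P1 →ₗ[ℝ] (Dom →ₗ[ℂ] Dom)) (f : Trig) (ψ : Dom) (t : ℝ) : ℂ :=
  (Q (L1 f) ψ : ℝ → ℂ) t + Complex.I * ((f : ℝ → ℝ) t : ℂ) * deriv (ψ : ℝ → ℂ) t
    + Complex.I / 2 * ((deriv (f : ℝ → ℝ) t : ℝ) : ℂ) * (ψ : ℝ → ℂ) t
    - (ν : ℂ) * ((f : ℝ → ℝ) t : ℂ) * (ψ : ℝ → ℂ) t

theorem Tf_cont (f : Trig) (ψ : Dom) : Continuous (Tf ν Q f ψ) := by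
  have h1 := dom_cont (Q (L1 f) ψ)
  have h2 := dom_cont ψ
  have h3 := dom_dcont ψ
  have h4 := tr_cont f
  have h5 := tr_dcont f
  unfold Tf
  fun_prop

theorem Tf_per (f : Trig) (ψ : Dom) (t : ℝ) : Tf ν Q f ψ (t + 2 * Real.pi) = Tf ν Q f ψ t := by
  unfold Tf
  rw [(Q (L1 f) ψ).2.2, ψ.2.2, dom_dper, trig_per f.2, trig_per (trig_deriv f.2)]

theorem Q0_deriv (hQ : IsQuant P1 ν Q) (g : Trig) (ψ : Dom) (t : ℝ) :
    deriv (Q (L0 g) ψ : ℝ → ℂ) t = ((deriv (g : ℝ → ℝ) t : ℝ) : ℂ) * (ψ : ℝ → ℂ) t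
      + ((g : ℝ → ℝ) t : ℂ) * deriv (ψ : ℝ → ℂ) t := by
  have : (Q (L0 g) ψ : ℝ → ℂ) = fun t => ((g : ℝ → ℝ) t : ℂ) * (ψ : ℝ → ℂ) t := funext (Q0_all hQ g ψ)
  rw [this]
  exact ((tr_hd g t).ofReal_comp.mul (dom_hd ψ t)).deriv

theorem Tf_comm (hQ : IsQuant P1 ν Q) (f g : Trig) (ψ : Dom) (t : ℝ) :
    Tf ν Q f (Q (L0 g) ψ) t = ((g : ℝ → ℝ) t : ℂ) * Tf ν Q f ψ t := by
  have h := brk10 hQ f g ⟨(f : ℝ → ℝ) * deriv (g : ℝ → ℝ), trig_mul f.2 (trig_deriv g.2)⟩ (fun t => rfl) ψ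
  have h' : (Q (L0 ⟨(f : ℝ → ℝ) * deriv (g : ℝ → ℝ), trig_mul f.2 (trig_deriv g.2)⟩) ψ : ℝ → ℂ) t = _ :=
    congrArg (fun x : Dom => (x : ℝ → ℂ) t) h
  simp only [Submodule.coe_sub, Submodule.coe_smul, Pi.sub_apply, Pi.smul_apply,
    smul_eq_mul, Q0_all hQ, Pi.mul_apply] at h'
  unfold Tf
  rw [Q0_all hQ, Q0_deriv hQ]
  push_cast at h'
  linear_combination Complex.I * h' + ((Q (L1 f) (Q (L0 g) ψ) : ℝ → ℂ) t - ((g : ℝ → ℝ) t : ℂ) * (Q (L1 f) ψ : ℝ → ℂ) t) * Complex.I_sq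

theorem Tf_symm (hQ : IsQuant P1 ν Q) (f : Trig) (φ ψ : Dom) :
    ∫ t in (0:ℝ)..(2 * Real.pi), (starRingEnd ℂ) (Tf ν Q f φ t) * (ψ : ℝ → ℂ) t =
    ∫ t in (0:ℝ)..(2 * Real.pi), (starRingEnd ℂ) ((φ : ℝ → ℂ) t) * Tf ν Q f ψ t := by
  have hs := hQ.symm (L1 f) φ ψ
  unfold ip at hs
  have c1 := dom_cont (Q (L1 f) ψ)
  have c1' := dom_cont (Q (L1 f) φ)
  have c2 := dom_cont ψ
  have c2' := dom_cont φ
  have c3 := dom_dcont ψ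
  have c3' := dom_dcont φ
  have c4 := tr_cont f
  have c5 := tr_dcont f
  have c6 := Tf_cont (ν := ν) (Q := Q) f φ
  have c7 := Tf_cont (ν := ν) (Q := Q) f ψ
  have cc : Continuous (starRingEnd ℂ) := Complex.continuous_conj
  let G : ℝ → ℂ := fun t => ((f : ℝ → ℝ) t : ℂ) * ((starRingEnd ℂ) ((φ : ℝ → ℂ) t) * (ψ : ℝ → ℂ) t)
  let G' : ℝ → ℂ := fun t => ((deriv (f : ℝ → ℝ) t : ℝ) : ℂ) * ((starRingEnd ℂ) ((φ : ℝ → ℂ) t) * (ψ : ℝ → ℂ) t) +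
      ((f : ℝ → ℝ) t : ℂ) * ((starRingEnd ℂ) (deriv (φ : ℝ → ℂ) t) * (ψ : ℝ → ℂ) t + (starRingEnd ℂ) ((φ : ℝ → ℂ) t) * deriv (ψ : ℝ → ℂ) t)
  have hG : ∀ t, HasDerivAt G (G' t) t := by
    intro t
    exact (tr_hd f t).ofReal_comp.mul ((dom_hd φ t).star_conj.mul (dom_hd ψ t))
  have cG' : Continuous G' := by
    simp only [G']
    fun_prop
  have hI : ∫ t in (0:ℝ)..(2 * Real.pi), G' t = 0 := by
    rw [intervalIntegral.integral_eq_sub_of_hasDerivAt (fun t _ => hG t) (cG'.intervalIntegrable _ _)]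
    have h1 := φ.2.2 0
    have h2 := ψ.2.2 0
    have h3 := trig_per f.2 0
    rw [zero_add] at h1 h2 h3
    simp only [G, h1, h2, h3, sub_self]
  have i1 : IntervalIntegrable (fun t => (starRingEnd ℂ) ((Q (L1 f) φ : ℝ → ℂ) t) * (ψ : ℝ → ℂ) t) MeasureTheory.volume 0 (2 * Real.pi) :=
    Continuous.intervalIntegrable (by fun_prop) _ _
  have i2 : IntervalIntegrable (fun t => (starRingEnd ℂ) ((φ : ℝ → ℂ) t) * (Q (L1 f) ψ : ℝ → ℂ) t) MeasureTheory.volume 0 (2 * Real.pi) :=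
    Continuous.intervalIntegrable (by fun_prop) _ _
  have i3 : IntervalIntegrable (fun t => (starRingEnd ℂ) (Tf ν Q f φ t) * (ψ : ℝ → ℂ) t) MeasureTheory.volume 0 (2 * Real.pi) :=
    Continuous.intervalIntegrable (by fun_prop) _ _
  have i4 : IntervalIntegrable (fun t => (starRingEnd ℂ) ((φ : ℝ → ℂ) t) * Tf ν Q f ψ t) MeasureTheory.volume 0 (2 * Real.pi) :=
    Continuous.intervalIntegrable (by fun_prop) _ _
  rw [← sub_eq_zero, ← intervalIntegral.integral_sub i1 i2] at hs
  rw [← sub_eq_zero, ← intervalIntegral.integral_sub i3 i4]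
  have : ∀ t, (starRingEnd ℂ) (Tf ν Q f φ t) * (ψ : ℝ → ℂ) t - (starRingEnd ℂ) ((φ : ℝ → ℂ) t) * Tf ν Q f ψ t =
    ((starRingEnd ℂ) ((Q (L1 f) φ : ℝ → ℂ) t) * (ψ : ℝ → ℂ) t - (starRingEnd ℂ) ((φ : ℝ → ℂ) t) * (Q (L1 f) ψ : ℝ → ℂ) t) + (-Complex.I) * G' t := by
    intro t
    simp only [Tf, G', map_add, map_sub, map_mul, map_div₀, Complex.conj_I, Complex.conj_ofReal, map_ofNat]
    ring
  simp only [this]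
  have i5 : IntervalIntegrable (fun t => (-Complex.I) * G' t) MeasureTheory.volume 0 (2 * Real.pi) :=
    Continuous.intervalIntegrable (by fun_prop) _ _
  rw [intervalIntegral.integral_add (i1.sub i2) i5, hs,
    intervalIntegral.integral_const_mul, hI]
  simp

theorem Tf_mul (hQ : IsQuant P1 ν Q) (f : Trig) (ψ : Dom) (t : ℝ) :
    Tf ν Q f ψ t = (starRingEnd ℂ) (Tf ν Q f oneD t) * (ψ : ℝ → ℂ) t := by
  have c2 := dom_cont ψ
  have c6 := Tf_cont (ν := ν) (Q := Q) f oneD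
  have c7 := Tf_cont (ν := ν) (Q := Q) f ψ
  have cc : Continuous (starRingEnd ℂ) := Complex.continuous_conj
  have gen : ∀ g : Trig, ∫ t in (0:ℝ)..(2 * Real.pi),
      ((starRingEnd ℂ) (Tf ν Q f ψ t) - (starRingEnd ℂ) ((ψ : ℝ → ℂ) t) * Tf ν Q f oneD t) * ((g : ℝ → ℝ) t : ℂ) = 0 := by
    intro g
    have c4 := tr_cont g
    have := Tf_symm hQ f ψ (Q (L0 g) oneD)
    simp only [Tf_comm hQ, Q0_all hQ, oneD_apply, mul_one] at this
    rw [← sub_eq_zero, ← intervalIntegral.integral_sub (Continuous.intervalIntegrable (by fun_prop) _ _)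
      (Continuous.intervalIntegrable (by fun_prop) _ _)] at this
    rw [← this]
    congr 1
    funext t
    ring
  have := fourier_uniq (fun t => (starRingEnd ℂ) (Tf ν Q f ψ t) - (starRingEnd ℂ) ((ψ : ℝ → ℂ) t) * Tf ν Q f oneD t)
    (by fun_prop) (by intro t; simp only [Tf_per, ψ.2.2]) (fun n => gen (cn n)) (fun n => gen (sn n)) t
  have h := congrArg (starRingEnd ℂ) this
  simp only [map_sub, map_mul, Complex.conj_conj, map_zero] at h
  linear_combination h

def bb (ν : ℝ) (Q : P1 →ₗ[ℝ] (Dom →ₗ[ℂ] Dom)) : Trig →ₗ[ℝ] (ℝ → ℂ) where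
  toFun f := fun t => Tf ν Q f oneD t
  map_add' f g := by
    funext t
    have : deriv ((f + g : Trig) : ℝ → ℝ) t = deriv (f : ℝ → ℝ) t + deriv (g : ℝ → ℝ) t :=
      deriv_add (trig_diff f.2 t) (trig_diff g.2 t)
    unfold Tf
    rw [this]
    simp only [map_add, LinearMap.add_apply, Submodule.coe_add, Pi.add_apply]
    push_cast
    ring
  map_smul' a f := by
    funext t
    have : deriv ((a • f : Trig) : ℝ → ℝ) t = a * deriv (f : ℝ → ℝ) t :=
      deriv_const_smul a (trig_diff f.2 t)
    unfold Tf
    rw [this]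
    simp only [map_smul, LinearMap.smul_apply, SetLike.val_smul_of_tower, Pi.smul_apply,
      Complex.real_smul, smul_eq_mul, RingHom.id_apply]
    push_cast
    ring

theorem bb_real (hQ : IsQuant P1 ν Q) (f : Trig) (t : ℝ) : (starRingEnd ℂ) (bb ν Q f t) = bb ν Q f t := by
  have := Tf_mul hQ f oneD t
  simp only [oneD_apply, mul_one] at this
  exact this.symm

theorem Q1_all (hQ : IsQuant P1 ν Q) (f : Trig) (ψ : Dom) (t : ℝ) :
    (Q (L1 f) ψ : ℝ → ℂ) t = -Complex.I * ((f : ℝ → ℝ) t : ℂ) * deriv (ψ : ℝ → ℂ) t +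
      (-(Complex.I / 2) * ((deriv (f : ℝ → ℝ) t : ℝ) : ℂ) + (ν : ℂ) * ((f : ℝ → ℝ) t : ℂ) + bb ν Q f t) * (ψ : ℝ → ℂ) t := by
  have h := Tf_mul hQ f ψ t
  have h2 : (starRingEnd ℂ) (Tf ν Q f oneD t) = bb ν Q f t := bb_real hQ f t
  rw [h2] at h
  unfold Tf at h
  linear_combination h

theorem bb_one (hQ : IsQuant P1 ν Q) (t : ℝ) : bb ν Q (cn 0) t = 0 := by
  have h1 := Q_ell hQ oneD t
  have h2 := Q1_all hQ (cn 0) oneD t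
  rw [h1] at h2
  simpa using h2

theorem bb_diff (f : Trig) : Differentiable ℝ (bb ν Q f) := by
  intro t
  have h1 := (dom_hd (Q (L1 f) oneD) t).differentiableAt
  have h2 := (tr_hd f t).ofReal_comp.differentiableAt
  have h3 := (tr_hd (dT f) t).ofReal_comp.differentiableAt
  have : bb ν Q f = fun t => (Q (L1 f) oneD : ℝ → ℂ) t + Complex.I / 2 * ((dT f : ℝ → ℝ) t : ℂ)
      - (ν : ℂ) * ((f : ℝ → ℝ) t : ℂ) := by
    funext t
    simp [bb, Tf, dT]
  rw [this]
  exact (h1.add (h3.const_mul _)).sub (h2.const_mul _)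

theorem w_deriv (hQ : IsQuant P1 ν Q) (f : Trig) (t : ℝ) :
    deriv (Q (L1 f) oneD : ℝ → ℂ) t = -(Complex.I / 2) * ((deriv (dT f : ℝ → ℝ) t : ℝ) : ℂ) +
      (ν : ℂ) * ((deriv (f : ℝ → ℝ) t : ℝ) : ℂ) + deriv (bb ν Q f) t := by
  have : (Q (L1 f) oneD : ℝ → ℂ) = fun t => -(Complex.I / 2) * ((dT f : ℝ → ℝ) t : ℂ) +
      (ν : ℂ) * ((f : ℝ → ℝ) t : ℂ) + bb ν Q f t := by
    funext t
    rw [Q1_all hQ]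
    simp [dT]
  rw [this]
  exact ((((tr_hd (dT f) t).ofReal_comp.const_mul _).add ((tr_hd f t).ofReal_comp.const_mul _)).add
    (bb_diff f t).hasDerivAt).deriv

theorem bb_brk0 (hQ : IsQuant P1 ν Q) (f g h : Trig)
    (e : ∀ t, (h : ℝ → ℝ) t = (f : ℝ → ℝ) t * deriv (g : ℝ → ℝ) t - deriv (f : ℝ → ℝ) t * (g : ℝ → ℝ) t) (t : ℝ) :
    bb ν Q h t = ((f : ℝ → ℝ) t : ℂ) * deriv (bb ν Q g) t - ((g : ℝ → ℝ) t : ℂ) * deriv (bb ν Q f) t := by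
  have k := congrArg (fun x : Dom => (x : ℝ → ℂ) t) (brk11 hQ f g h e oneD)
  have hd : deriv (h : ℝ → ℝ) t = (f : ℝ → ℝ) t * deriv (dT g : ℝ → ℝ) t - deriv (dT f : ℝ → ℝ) t * (g : ℝ → ℝ) t := by
    have : (h : ℝ → ℝ) = fun t => (f : ℝ → ℝ) t * (dT g : ℝ → ℝ) t - (dT f : ℝ → ℝ) t * (g : ℝ → ℝ) t := funext e
    rw [this]
    refine (((tr_hd f t).mul (tr_hd (dT g) t)).sub ((tr_hd (dT f) t).mul (tr_hd g t))).deriv.trans ?_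
    simp only [dT]
    ring
  simp only [Submodule.coe_sub, Submodule.coe_smul, Pi.sub_apply, Pi.smul_apply, smul_eq_mul] at k
  rw [Q1_all hQ h, Q1_all hQ f (Q (L1 g) oneD), Q1_all hQ g (Q (L1 f) oneD), w_deriv hQ, w_deriv hQ,
    Q1_all hQ f, Q1_all hQ g, hd, e] at k
  simp only [oneD_apply, oneD_deriv] at k
  push_cast at k
  generalize deriv (bb ν Q f) t = x1 at *
  generalize deriv (bb ν Q g) t = x2 at *
  generalize ((deriv (dT f : ℝ → ℝ) t : ℝ) : ℂ) = x3 at *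
  generalize ((deriv (dT g : ℝ → ℝ) t : ℝ) : ℂ) = x4 at *
  generalize ((f : ℝ → ℝ) t : ℂ) = x5 at *
  generalize ((g : ℝ → ℝ) t : ℂ) = x6 at *
  generalize ((deriv (f : ℝ → ℝ) t : ℝ) : ℂ) = x7 at *
  generalize ((deriv (g : ℝ → ℝ) t : ℝ) : ℂ) = x8 at *
  have hI := Complex.I_sq
  generalize Complex.I = i at *
  linear_combination k + (-(x5 * (-(i/2) * x4 + ν * x8 + x2)) + x6 * (-(i/2) * x3 + ν * x7 + x1)) * hI

theorem bb_deriv (hQ : IsQuant P1 ν Q) (f : Trig) (t : ℝ) : deriv (bb ν Q f) t = bb ν Q (dT f) t := by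
  have h := bb_brk0 hQ (cn 0) f (dT f) (by intro t; simp [dT]) t
  have h0 : bb ν Q (cn 0) = fun _ => 0 := funext (bb_one hQ)
  rw [h, h0]
  simp

theorem bb_brk (hQ : IsQuant P1 ν Q) (f g h : Trig)
    (e : ∀ t, (h : ℝ → ℝ) t = (f : ℝ → ℝ) t * deriv (g : ℝ → ℝ) t - deriv (f : ℝ → ℝ) t * (g : ℝ → ℝ) t) (t : ℝ) :
    bb ν Q h t = ((f : ℝ → ℝ) t : ℂ) * bb ν Q (dT g) t - ((g : ℝ → ℝ) t : ℂ) * bb ν Q (dT f) t := by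
  rw [bb_brk0 hQ f g h e, bb_deriv hQ, bb_deriv hQ]

theorem dT_sn (n : ℕ) : dT (sn n) = (n : ℝ) • cn n := by
  ext t; simp [dT]
theorem dT_cn (n : ℕ) : dT (cn n) = (-(n : ℝ)) • sn n := by
  ext t; simp [dT]

theorem bb_base (hQ : IsQuant P1 ν Q) : ∃ η : ℝ, ∀ t, bb ν Q (cn 1) t = -(η : ℂ) * (Real.sin t : ℂ) ∧
    bb ν Q (sn 1) t = (η : ℂ) * (Real.cos t : ℂ) := by
  have hs : ∀ t, deriv (bb ν Q (sn 1)) t = bb ν Q (cn 1) t := by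
    intro t; rw [bb_deriv hQ, dT_sn]; simp
  have hc : ∀ t, deriv (bb ν Q (cn 1)) t = -bb ν Q (sn 1) t := by
    intro t; rw [bb_deriv hQ, dT_cn]; simp
  have h1 : ∀ t, (Real.cos t : ℂ) * bb ν Q (cn 1) t + (Real.sin t : ℂ) * bb ν Q (sn 1) t = 0 := by
    intro t
    have h := bb_brk0 hQ (cn 1) (sn 1) (cn 0) (by
      intro t; simp; linear_combination -Real.sin_sq_add_cos_sq t) t
    rw [bb_one hQ, hs, hc] at h
    simp only [cn_apply, sn_apply, Nat.cast_one, one_mul] at h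
    linear_combination -h
  let ρ : ℝ → ℂ := fun t => (Real.cos t : ℂ) * bb ν Q (sn 1) t - (Real.sin t : ℂ) * bb ν Q (cn 1) t
  have hρ : ∀ t, HasDerivAt ρ 0 t := by
    intro t
    have a1 := (Real.hasDerivAt_cos t).ofReal_comp.mul (bb_diff (ν := ν) (Q := Q) (sn 1) t).hasDerivAt
    have a2 := (Real.hasDerivAt_sin t).ofReal_comp.mul (bb_diff (ν := ν) (Q := Q) (cn 1) t).hasDerivAt
    have a3 : HasDerivAt ρ _ t := a1.sub a2
    refine a3.congr_deriv ?_
    rw [hs, hc]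
    push_cast
    ring
  have hconst : ∀ t, ρ t = ρ 0 := fun t =>
    is_const_of_deriv_eq_zero (fun t => (hρ t).differentiableAt) (fun t => (hρ t).deriv) t 0
  have h0 : ρ 0 = bb ν Q (sn 1) 0 := by simp [ρ]
  obtain ⟨η, hη⟩ := Complex.conj_eq_iff_real.1 (bb_real hQ (sn 1) 0)
  refine ⟨η, fun t => ?_⟩
  have e1 := hconst t
  rw [h0, hη] at e1
  have e2 := h1 t
  simp only [ρ] at e1
  have sc : (Real.sin t : ℂ) ^ 2 + (Real.cos t : ℂ) ^ 2 = 1 := by exact_mod_cast Real.sin_sq_add_cos_sq t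
  constructor
  · linear_combination (-(Real.sin t : ℂ)) * e1 + (Real.cos t : ℂ) * e2 - bb ν Q (cn 1) t * sc
  · linear_combination ((Real.cos t : ℂ)) * e1 + (Real.sin t : ℂ) * e2 - bb ν Q (sn 1) t * sc

theorem bb_cs (hQ : IsQuant P1 ν Q) (η : ℝ) (hη : ∀ t, bb ν Q (cn 1) t = -(η : ℂ) * (Real.sin t : ℂ) ∧
    bb ν Q (sn 1) t = (η : ℂ) * (Real.cos t : ℂ)) (n : ℕ) : ∀ t : ℝ,
    bb ν Q (cn n) t = -(η : ℂ) * n * (Real.sin (n * t) : ℂ) ∧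
    bb ν Q (sn n) t = (η : ℂ) * n * (Real.cos (n * t) : ℂ) := by
  induction n with
  | zero => intro t; rw [bb_one hQ, sn0]; simp
  | succ n ih =>
    intro t
    obtain ⟨i1, i2⟩ := ih t
    obtain ⟨j1, j2⟩ := hη t
    have ec : ∀ t : ℝ, Real.cos (((n + 1 : ℕ) : ℝ) * t) = Real.cos (n * t) * Real.cos t - Real.sin (n * t) * Real.sin t := by
      intro t; push_cast; rw [add_mul, Real.cos_add, one_mul]
    have es : ∀ t : ℝ, Real.sin (((n + 1 : ℕ) : ℝ) * t) = Real.sin (n * t) * Real.cos t + Real.cos (n * t) * Real.sin t := by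
      intro t; push_cast; rw [add_mul, Real.sin_add, one_mul]
    have ec2 : ∀ t : ℝ, Real.cos (((n + 2 : ℕ) : ℝ) * t) = Real.cos (n * t) * (Real.cos t ^ 2 - Real.sin t ^ 2) - Real.sin (n * t) * (2 * Real.sin t * Real.cos t) := by
      intro t; push_cast; rw [add_mul, Real.cos_add, Real.cos_two_mul', Real.sin_two_mul]
    have es2 : ∀ t : ℝ, Real.sin (((n + 2 : ℕ) : ℝ) * t) = Real.sin (n * t) * (Real.cos t ^ 2 - Real.sin t ^ 2) + Real.cos (n * t) * (2 * Real.sin t * Real.cos t) := by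
      intro t; push_cast; rw [add_mul, Real.sin_add, Real.cos_two_mul', Real.sin_two_mul]
    have k1 := bb_brk hQ (cn 1) (cn (n + 1)) ((1/2 : ℝ) • ((-(n : ℝ)) • sn (n + 2) - ((n : ℝ) + 2) • sn n)) (by
        intro t
        simp only [Submodule.coe_sub, Submodule.coe_smul, Pi.sub_apply, Pi.smul_apply, smul_eq_mul, cn_apply, sn_apply, cn_deriv, ec, es, es2]
        have sc := Real.sin_sq_add_cos_sq t
        push_cast
        simp only [one_mul]
        linear_combination (1/2 : ℝ) * ((n : ℝ) + 2) * Real.sin (n * t) * sc) t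
    have k2 := bb_brk hQ (sn 1) (sn (n + 1)) ((1/2 : ℝ) • (((n : ℝ)) • sn (n + 2) - ((n : ℝ) + 2) • sn n)) (by
        intro t
        simp only [Submodule.coe_sub, Submodule.coe_smul, Pi.sub_apply, Pi.smul_apply, smul_eq_mul, sn_apply, sn_deriv, ec, es, es2]
        have sc := Real.sin_sq_add_cos_sq t
        push_cast
        simp only [one_mul]
        linear_combination (1/2 : ℝ) * ((n : ℝ) + 2) * Real.sin (n * t) * sc) t
    have k3 := bb_brk hQ (cn 1) (sn (n + 1)) ((1/2 : ℝ) • (((n : ℝ)) • cn (n + 2) + ((n : ℝ) + 2) • cn n)) (by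
        intro t
        simp only [Submodule.coe_add, Submodule.coe_smul, Pi.add_apply, Pi.smul_apply, smul_eq_mul, cn_apply, sn_apply, cn_deriv, sn_deriv, ec, es, ec2]
        have sc := Real.sin_sq_add_cos_sq t
        push_cast
        simp only [one_mul]
        linear_combination (-(1/2) : ℝ) * ((n : ℝ) + 2) * Real.cos (n * t) * sc) t
    have k4 := bb_brk hQ (sn 1) (cn (n + 1)) ((1/2 : ℝ) • (((n : ℝ)) • cn (n + 2) - ((n : ℝ) + 2) • cn n)) (by
        intro t
        simp only [Submodule.coe_sub, Submodule.coe_smul, Pi.sub_apply, Pi.smul_apply, smul_eq_mul, cn_apply, sn_apply, cn_deriv, sn_deriv, ec, es, ec2]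
        have sc := Real.sin_sq_add_cos_sq t
        push_cast
        simp only [one_mul]
        linear_combination ((1/2) : ℝ) * ((n : ℝ) + 2) * Real.cos (n * t) * sc) t
    have sc : (Real.sin t : ℂ) ^ 2 + (Real.cos t : ℂ) ^ 2 = 1 := by exact_mod_cast Real.sin_sq_add_cos_sq t
    simp only [dT_sn, dT_cn, map_smul, map_add, map_sub, Pi.add_apply, Pi.sub_apply, Pi.smul_apply, Complex.real_smul,
      i1, i2, j1, j2, cn_apply, sn_apply, ec, es] at k1 k2 k3 k4
    rw [ec, es]
    have hm : ((n : ℂ) + 1) ≠ 0 := by exact_mod_cast Nat.succ_ne_zero n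
    push_cast at *
    simp only [one_mul] at *
    generalize bb ν Q (cn (n + 1)) t = C at *
    generalize bb ν Q (sn (n + 1)) t = S at *
    generalize Complex.sin t = s at *
    generalize Complex.cos t = c at *
    generalize Complex.sin (n * t) = x at *
    generalize Complex.cos (n * t) = y at *
    have r1 : ((n : ℂ) + 1) * (s * C - c * S + η * (n + 1) * y) = 0 := by
      linear_combination -k1 - k2 - η * y * sc
    have r2 : ((n : ℂ) + 1) * (c * C + s * S + η * (n + 1) * x) = 0 := by
      linear_combination -k3 + k4 - η * x * sc
    replace r1 := (mul_eq_zero.1 r1).resolve_left hm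
    replace r2 := (mul_eq_zero.1 r2).resolve_left hm
    constructor
    · linear_combination s * r1 + c * r2 - C * sc
    · linear_combination -c * r1 + s * r2 - S * sc

theorem bb_all (hQ : IsQuant P1 ν Q) (η : ℝ) (hη : ∀ t, bb ν Q (cn 1) t = -(η : ℂ) * (Real.sin t : ℂ) ∧
    bb ν Q (sn 1) t = (η : ℂ) * (Real.cos t : ℂ)) (f : Trig) (t : ℝ) :
    bb ν Q f t = (η : ℂ) * ((deriv (f : ℝ → ℝ) t : ℝ) : ℂ) := by
  obtain ⟨f, hf⟩ := f
  refine Submodule.span_induction (p := fun f hf => bb ν Q ⟨f, hf⟩ t = (η : ℂ) * ((deriv f t : ℝ) : ℂ)) ?_ ?_ ?_ ?_ hf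
  · rintro x ⟨m, rfl | rfl⟩
    · rw [deriv_sin_m]
      refine ((bb_cs hQ η hη m t).2).trans ?_
      push_cast; ring
    · rw [deriv_cos_m]
      refine ((bb_cs hQ η hη m t).1).trans ?_
      push_cast; ring
  · have : (⟨0, Trig.zero_mem⟩ : Trig) = 0 := rfl
    erw [this]; simp
  · intro x y hx hy h1 h2
    have : (⟨x + y, Trig.add_mem hx hy⟩ : Trig) = ⟨x, hx⟩ + ⟨y, hy⟩ := rfl
    erw [this]
    rw [map_add, Pi.add_apply, h1, h2, deriv_add (trig_diff hx t) (trig_diff hy t)]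
    push_cast; ring
  · intro a x hx h1
    have : (⟨a • x, Trig.smul_mem a hx⟩ : Trig) = a • ⟨x, hx⟩ := rfl
    erw [this]
    rw [map_smul, Pi.smul_apply, h1, deriv_const_smul a (trig_diff hx t), Complex.real_smul]
    simp; ring

end
end
noncomputable section
/-- Uniqueness of the quantizations of `P¹`: every admissible quantization of `P¹` of
type (i)′ with parameter `ν` equals `Q_{ν,η}` for some `η ∈ ℝ`. -/
theorem stmt17 (ν : ℝ) (Q : P1 →ₗ[ℝ] (Dom →ₗ[ℂ] Dom)) (hQ : IsQuant P1 ν Q) :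
    ∃ η : ℝ, ∀ (f g : ℝ → ℝ), f ∈ Trig → g ∈ Trig →
      ∀ (h : (fun p : ℝ × ℝ => f p.1 * p.2 + g p.1) ∈ P1) (ψ : Dom) (t : ℝ),
        (Q ⟨fun p : ℝ × ℝ => f p.1 * p.2 + g p.1, h⟩ ψ : ℝ → ℂ) t =
          -Complex.I * (f t : ℂ) * deriv (ψ : ℝ → ℂ) t +
            (((η : ℂ) - Complex.I / 2) * (Complex.ofReal (deriv f t)) +
              (ν : ℂ) * (f t : ℂ) + (g t : ℂ)) * (ψ : ℝ → ℂ) t := by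
  obtain ⟨η, hη⟩ := bb_base hQ
  refine ⟨η, fun f g hf hg h ψ t => ?_⟩
  have e : (⟨fun p : ℝ × ℝ => f p.1 * p.2 + g p.1, h⟩ : P1) = L1 ⟨f, hf⟩ + L0 ⟨g, hg⟩ := rfl
  rw [e, map_add, LinearMap.add_apply, Submodule.coe_add, Pi.add_apply, Q1_all hQ, Q0_all hQ, bb_all hQ η hη]
  ring
end
end

section
/- Let C be the space of smooth functions f : ℝ² → ℝ, with coordinates (θ, ℓ), satisfying f(θ + 2π, ℓ) = f(θ, ℓ) (smooth functions on the cylinder T*S¹), equipped with the Poisson bracket {f, g} = (∂f/∂ℓ)(∂g/∂θ) − (∂f/∂θ)(∂g/∂ℓ). Then the normalizer of B in C equals B: {f ∈ C : {f, b} ∈ B for every b ∈ B} = B. -/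
noncomputable section
/-- The basic set `B = span{1, ℓ, sin θ, cos θ}`. -/
def Bsub : Submodule ℝ (ℝ × ℝ → ℝ) := Submodule.span ℝ {fone, fell, fsin, fcos}

/-- Smooth functions on the cylinder `T*S¹`, i.e. smooth functions on `ℝ²` that are
`2π`-periodic in the angle variable. -/
def CylFns : Set (ℝ × ℝ → ℝ) :=
  {f | ContDiff ℝ (⊤ : ℕ∞) f ∧ ∀ (θ l : ℝ), f (θ + 2 * Real.pi, l) = f (θ, l)}

lemma mem_Bsub_iff (g : ℝ × ℝ → ℝ) : g ∈ Bsub ↔ ∃ a b c d : ℝ, g = fun p : ℝ × ℝ =>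
    a + b * p.2 + c * Real.sin p.1 + d * Real.cos p.1 := by
  unfold Bsub
  simp only [Submodule.mem_span_insert, Submodule.mem_span_singleton]
  constructor
  · rintro ⟨a, _, ⟨b, _, ⟨c, _, ⟨d, rfl⟩, rfl⟩, rfl⟩, rfl⟩
    refine ⟨a, b, c, d, ?_⟩
    funext p
    simp [fone, fell, fsin, fcos]
    ring
  · rintro ⟨a, b, c, d, rfl⟩
    refine ⟨a, _, ⟨b, _, ⟨c, _, ⟨d, rfl⟩, rfl⟩, rfl⟩, ?_⟩
    funext p
    simp [fone, fell, fsin, fcos]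
    ring

lemma pdTheta_B (a b c d : ℝ) : pdTheta (fun p : ℝ × ℝ =>
    a + b * p.2 + c * Real.sin p.1 + d * Real.cos p.1) =
    fun p => c * Real.cos p.1 - d * Real.sin p.1 := by
  funext p
  have h := (((Real.hasDerivAt_sin p.1).const_mul c).const_add (a + b * p.2)).add
    ((Real.hasDerivAt_cos p.1).const_mul d)
  refine (HasDerivAt.deriv h).trans ?_
  ring

lemma pdEll_B (a b c d : ℝ) : pdEll (fun p : ℝ × ℝ =>
    a + b * p.2 + c * Real.sin p.1 + d * Real.cos p.1) = fun _ => b := by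
  funext p
  have h := ((((hasDerivAt_id p.2).const_mul b).const_add a).add_const
    (c * Real.sin p.1)).add_const (d * Real.cos p.1)
  refine (HasDerivAt.deriv h).trans ?_
  ring

/-- The normalizer of `B` in the Poisson algebra of the cylinder is `B` itself. -/
theorem stmt19 :
    {f : ℝ × ℝ → ℝ | f ∈ CylFns ∧ ∀ b ∈ Bsub, pb f b ∈ Bsub} = (Bsub : Set (ℝ × ℝ → ℝ)) := by
  ext f
  simp only [Set.mem_setOf_eq, SetLike.mem_coe]
  constructor
  · rintro ⟨⟨hs, hper⟩, hn⟩
    have hd : Differentiable ℝ f := hs.differentiable (by simp)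
    have hdt : ∀ l, Differentiable ℝ (fun t => f (t, l)) := fun l => by fun_prop
    have hdl : Differentiable ℝ (fun l => f (0, l)) := by fun_prop
    have hell : fell = fun p : ℝ × ℝ =>
        0 + 1 * p.2 + 0 * Real.sin p.1 + 0 * Real.cos p.1 := by
      funext p; simp [fell]
    have hsin : fsin = fun p : ℝ × ℝ =>
        0 + 0 * p.2 + 1 * Real.sin p.1 + 0 * Real.cos p.1 := by
      funext p; simp [fsin]
    obtain ⟨a, b, c, d, h1⟩ := (mem_Bsub_iff _).1
      (hn fell ((mem_Bsub_iff _).2 ⟨_, _, _, _, hell⟩))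
    obtain ⟨a', b', c', d', h2⟩ := (mem_Bsub_iff _).1
      (hn fsin ((mem_Bsub_iff _).2 ⟨_, _, _, _, hsin⟩))
    have k1 : ∀ t l, deriv (fun t => f (t, l)) t =
        -(a + b * l + c * Real.sin t + d * Real.cos t) := by
      intro t l
      have := congrFun h1 (t, l)
      simp only [pb] at this
      rw [hell, pdTheta_B, pdEll_B] at this
      simp only [pdTheta] at this
      linarith
    have k2 : ∀ t l, deriv (fun l => f (t, l)) l * Real.cos t =
        a' + b' * l + c' * Real.sin t + d' * Real.cos t := by
      intro t l
      have := congrFun h2 (t, l)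
      simp only [pb] at this
      rw [hsin, pdTheta_B, pdEll_B] at this
      simp only [pdEll] at this
      linarith
    have k3 : ∀ t l, f (t, l) = f (0, l) - (a + b * l) * t + c * Real.cos t - c
        - d * Real.sin t := by
      intro t l
      have hu : ∀ x, HasDerivAt (fun t => f (t, l) + (a + b * l) * t - c * Real.cos t
          + d * Real.sin t) 0 x := by
        intro x
        have h := ((((hdt l x).hasDerivAt).add ((hasDerivAt_id x).const_mul (a + b * l))).sub
          ((Real.hasDerivAt_cos x).const_mul c)).add ((Real.hasDerivAt_sin x).const_mul d)
        refine h.congr_deriv ?_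
        rw [k1]; ring
      have := is_const_of_deriv_eq_zero (fun x => (hu x).differentiableAt)
        (fun x => (hu x).deriv) t 0
      simp at this
      linarith
    have k4 : ∀ l, a + b * l = 0 := by
      intro l
      have e1 := k3 (2 * Real.pi) l
      have e2 := hper 0 l
      rw [zero_add] at e2
      simp at e1
      have : (a + b * l) * (2 * Real.pi) = 0 := by linarith
      have hp := Real.pi_pos
      rcases mul_eq_zero.1 this with h | h
      · exact h
      · linarith
    have k5 : ∀ t l, f (t, l) = f (0, l) + (c * Real.cos t - c - d * Real.sin t) := by
      intro t l
      rw [k3 t l, k4 l]; ring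
    have k6 : ∀ l, deriv (fun l => f (0, l)) l = d' := by
      intro l
      have e0 := k2 0 l
      have e1 := k2 Real.pi l
      have : (fun l => f (Real.pi, l)) = fun l => f (0, l) +
          (c * Real.cos Real.pi - c - d * Real.sin Real.pi) := by
        funext l; exact k5 _ l
      rw [this, deriv_add_const] at e1
      simp at e0 e1
      linarith
    have k7 : ∀ l, f (0, l) = f (0, 0) + d' * l := by
      intro l
      have hu : ∀ x, HasDerivAt (fun l => f (0, l) - d' * l) 0 x := by
        intro x
        have h := ((hdl x).hasDerivAt).sub ((hasDerivAt_id x).const_mul d')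
        refine h.congr_deriv ?_
        rw [k6]; ring
      have := is_const_of_deriv_eq_zero (fun x => (hu x).differentiableAt)
        (fun x => (hu x).deriv) l 0
      simp at this
      linarith
    refine (mem_Bsub_iff _).2 ⟨f (0, 0) - c, d', -d, c, ?_⟩
    funext ⟨t, l⟩
    rw [k5, k7]; ring
  · intro hf
    obtain ⟨a, b, c, d, rfl⟩ := (mem_Bsub_iff _).1 hf
    refine ⟨⟨?_, ?_⟩, ?_⟩
    · have h1 : ContDiff ℝ (⊤ : ℕ∞) (fun p : ℝ × ℝ => Real.sin p.1) :=
        Real.contDiff_sin.comp contDiff_fst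
      have h2 : ContDiff ℝ (⊤ : ℕ∞) (fun p : ℝ × ℝ => Real.cos p.1) :=
        Real.contDiff_cos.comp contDiff_fst
      fun_prop
    · intro t l
      simp
    · intro g hg
      obtain ⟨a', b', c', d', rfl⟩ := (mem_Bsub_iff _).1 hg
      refine (mem_Bsub_iff _).2 ⟨0, 0, d * b' - b * d', b * c' - c * b', ?_⟩
      funext p
      simp only [pb]
      rw [pdTheta_B, pdEll_B, pdTheta_B, pdEll_B]
      ring

end
end
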